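/- Let μ be a probability measure on a measurable space α, let t ≥ 1, and for each i ∈ Fin t let w i, τ i : α → ℝ be measurable with 0 < w i x ≤ 1 and 0 < τ i x ≤ 1 for all x; let a : α → ℝ be measurable with 0 < a x ≤ 1; and let γ : Fin t → ℝ satisfy γ i > 0 and ∑_i γ i = 1. Assume all the functions x ↦ −log(w i x), x ↦ −log(τ i x), x ↦ −log(a x) are integrable, with ∫ −log(w i x) dμ ≤ δ for every i, ∫ ∑_i γ i · (−log(τ i x)) dμ ≤ ε, and ∫ −log(a x) dμ ≤ η. Then the DIL loss error max{∫ −log(∑_i w i x · τ i x) dμ, ∫ −log(a x) dμ} is at most max{δ + ε + log t, η}. -/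

import Mathlib

open MeasureTheory Real Finset

/-- Theorem (DIL sufficiency): if the expected WTP cross-entropies are bounded by δ,
the expected γ-weighted TII cross-entropy by ε and the expected TAP cross-entropy
by η, then the DIL loss error max{∫ −log(∑ i, w i x · τ i x), ∫ −log a} is at most
max{δ + ε + log t, η}. -/
theorem dil_sufficiency
    {α : Type*} [MeasurableSpace α] (μ : Measure α) [IsProbabilityMeasure μ]
    (t : ℕ) (ht : 1 ≤ t)
    (w τ : Fin t → α → ℝ) (a : α → ℝ) (γ : Fin t → ℝ)
    (hwMeas : ∀ i, Measurable (w i)) (hτMeas : ∀ i, Measurable (τ i))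
    (haMeas : Measurable a)
    (hw01 : ∀ i x, 0 < w i x ∧ w i x ≤ 1)
    (hτ01 : ∀ i x, 0 < τ i x ∧ τ i x ≤ 1)
    (ha01 : ∀ x, 0 < a x ∧ a x ≤ 1)
    (hγ : ∀ i, 0 < γ i) (hγsum : ∑ i, γ i = 1)
    (δ ε η : ℝ)
    (hwInt : ∀ i, Integrable (fun x => -Real.log (w i x)) μ)
    (hτInt : ∀ i, Integrable (fun x => -Real.log (τ i x)) μ)
    (haInt : Integrable (fun x => -Real.log (a x)) μ)
    (hwB : ∀ i, ∫ x, -Real.log (w i x) ∂μ ≤ δ)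
    (hτB : ∫ x, ∑ i, γ i * (-Real.log (τ i x)) ∂μ ≤ ε)
    (haB : ∫ x, -Real.log (a x) ∂μ ≤ η) :
    max (∫ x, -Real.log (∑ i, w i x * τ i x) ∂μ) (∫ x, -Real.log (a x) ∂μ) ≤
      max (δ + ε + Real.log t) η := by
  have hS : ∀ x, ∑ i, γ i * (w i x * τ i x) ≤ ∑ i, w i x * τ i x := by
    intro x
    refine Finset.sum_le_sum fun i _ => ?_
    have h1 : γ i ≤ 1 := by
      rw [← hγsum]
      exact Finset.single_le_sum (f := γ) (fun j _ => (hγ j).le) (Finset.mem_univ i)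
    have h2 := mul_pos (hw01 i x).1 (hτ01 i x).1
    nlinarith
  have hne : (Finset.univ : Finset (Fin t)).Nonempty := ⟨⟨0, ht⟩, Finset.mem_univ _⟩
  have hpos : ∀ x, 0 < ∑ i, γ i * (w i x * τ i x) := fun x =>
    Finset.sum_pos (fun i _ => mul_pos (hγ i) (mul_pos (hw01 i x).1 (hτ01 i x).1)) hne
  have hlogt : 0 ≤ Real.log t := Real.log_nonneg (by exact_mod_cast ht)
  have hup : ∀ x, -Real.log (∑ i, w i x * τ i x) ≤
      ∑ i, γ i * (-Real.log (w i x)) + ∑ i, γ i * (-Real.log (τ i x)) := by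
    intro x
    have hJ := strictConcaveOn_log_Ioi.concaveOn.le_map_sum (t := Finset.univ) (w := γ)
      (p := fun i => w i x * τ i x) (fun i _ => (hγ i).le) hγsum
      (fun i _ => mul_pos (hw01 i x).1 (hτ01 i x).1)
    simp only [smul_eq_mul] at hJ
    have hm := Real.log_le_log (hpos x) (hS x)
    have he : ∑ i, γ i * Real.log (w i x * τ i x) =
        -(∑ i, γ i * (-Real.log (w i x)) + ∑ i, γ i * (-Real.log (τ i x))) := by
      rw [← Finset.sum_add_distrib, ← Finset.sum_neg_distrib]
      refine Finset.sum_congr rfl fun i _ => ?_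
      rw [Real.log_mul (hw01 i x).1.ne' (hτ01 i x).1.ne']
      ring
    linarith
  have hlow : ∀ x, -Real.log t ≤ -Real.log (∑ i, w i x * τ i x) := by
    intro x
    refine neg_le_neg (Real.log_le_log ((hpos x).trans_le (hS x)) ?_)
    calc ∑ i, w i x * τ i x ≤ ∑ _i : Fin t, (1 : ℝ) := Finset.sum_le_sum fun i _ =>
          mul_le_one₀ (hw01 i x).2 (hτ01 i x).1.le (hτ01 i x).2
      _ = t := by simp
  have hI1 : Integrable (fun x => ∑ i, γ i * (-Real.log (w i x))) μ :=
    integrable_finsetSum _ fun i _ => (hwInt i).const_mul _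
  have hI2 : Integrable (fun x => ∑ i, γ i * (-Real.log (τ i x))) μ :=
    integrable_finsetSum _ fun i _ => (hτInt i).const_mul _
  have hmeas : Measurable (fun x => -Real.log (∑ i, w i x * τ i x)) :=
    (Real.measurable_log.comp
      (Finset.measurable_fun_sum _ fun i _ => (hwMeas i).mul (hτMeas i))).neg
  have hI : Integrable (fun x => -Real.log (∑ i, w i x * τ i x)) μ :=
    integrable_of_le_of_le hmeas.aestronglyMeasurable (Filter.Eventually.of_forall hlow)
      (Filter.Eventually.of_forall hup) (integrable_const _) (hI1.add hI2)
  have hmain := integral_mono hI (hI1.add hI2) hup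
  have hadd := integral_add hI1 hI2
  have hw : ∫ x, ∑ i, γ i * (-Real.log (w i x)) ∂μ ≤ δ := by
    rw [integral_finsetSum _ fun i _ => (hwInt i).const_mul _]
    calc ∑ i, ∫ x, γ i * (-Real.log (w i x)) ∂μ ≤ ∑ i, γ i * δ :=
          Finset.sum_le_sum fun i _ => by
            rw [integral_const_mul]
            exact mul_le_mul_of_nonneg_left (hwB i) (hγ i).le
      _ = δ := by rw [← Finset.sum_mul, hγsum, one_mul]
  refine max_le_max ?_ haB
  simp only [Pi.add_apply] at hmain
  linarith
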